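/- Assume (H), g strictly increasing, and c > c_* (encoded as: χ₀(·;c) has two distinct positive real zeros λ₁ < λ₂, and equation (E1) admits a monotone wavefront with speed c, which is unique up to translation, as well as a wavefront with some speed c' < c). Let w₀ : Π₀ → ℝ₊ be uniformly bounded by K > 0, satisfy (IC2), and satisfy lim_{z→−∞} w₀(s,z) e^{−λ₁ z} = 1 uniformly in s ∈ [−h,0]. Then for each ς > 0 there exist L ∈ ℝ and a C² function ψ : ℝ → ℝ such that: ψ(z) e^{−λ₁ z} → 1 + ς as z → −∞; ψ'(z) > 0 for all z ∈ ℝ; ψ(L) = K; ψ(z) → +∞ as z → +∞; w₀(s,z) < ψ(z) for all z ≤ L, s ∈ [−h,0]; and ψ''(z) − cψ'(z) − ψ(z) + g(ψ(z−ch)) < 0 for all z ≤ L. -/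

import Mathlib

open Set Filter

noncomputable section

/-- The weight function `η_λ(t) = min{e^{λt}, 1}`. -/
def eta (lam t : ℝ) : ℝ := min (Real.exp (lam * t)) 1

/-- The characteristic function `χ₀(λ) = λ² − cλ − 1 + g0·e^{−λch}` (with `g0 = g'(0)`). -/
def chi (g0 c h lam : ℝ) : ℝ := lam ^ 2 - c * lam - 1 + g0 * Real.exp (-(lam * c * h))

/-- Hypothesis (H) on the birth function `g` (extended linearly and C¹-smoothly to `(−∞,0]`). -/
structure HypH (g : ℝ → ℝ) (kap del0 Lg : ℝ) : Prop where
  cont : Continuous g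
  nonneg : ∀ x : ℝ, 0 ≤ x → 0 ≤ g x
  kap_pos : 0 < kap
  del0_pos : 0 < del0
  fixed_points : ∀ x : ℝ, 0 ≤ x → (g x = x ↔ x = 0 ∨ x = kap)
  smooth0 : ContDiffOn ℝ 1 g (Set.Ioo (-del0) del0)
  smooth_kap : ContDiffOn ℝ 1 g (Set.Ioo (kap - del0) (kap + del0))
  deriv0_gt : 1 < deriv g 0
  deriv_kap_lt : deriv g kap < 1
  lipschitz : ∀ u v : ℝ, 0 ≤ u → 0 ≤ v → |g u - g v| ≤ Lg * |u - v|
  holder : ∃ C > (0:ℝ), ∃ θ ∈ Set.Ioc (0:ℝ) 1,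
      ∀ u ∈ Set.Ioc (0:ℝ) del0, |deriv g u - deriv g 0| ≤ C * u ^ θ
  ext_linear : ∀ x : ℝ, x ≤ 0 → g x = deriv g 0 * x

/-- (IC1): `0 ≤ w₀ ≤ sup w₀ < ∞` on `Π₀ = [−h,0]×ℝ`. -/
def IC1 (h : ℝ) (w0 : ℝ → ℝ → ℝ) : Prop :=
  ∃ M : ℝ, ∀ s ∈ Set.Icc (-h) 0, ∀ x : ℝ, 0 ≤ w0 s x ∧ w0 s x ≤ M

/-- (IC2): `liminf_{x→+∞} min_{s∈[−h,0]} w₀(s,x) > 0`. -/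
def IC2 (h : ℝ) (w0 : ℝ → ℝ → ℝ) : Prop :=
  ∃ m > (0:ℝ), ∃ X : ℝ, ∀ x ≥ X, ∀ s ∈ Set.Icc (-h) 0, m ≤ w0 s x

/-- `w₀` is locally Hölder continuous in `x`, uniformly in `s ∈ [−h,0]`. -/
def LocHolder (h : ℝ) (w0 : ℝ → ℝ → ℝ) : Prop :=
  ∀ R > (0:ℝ), ∃ K > (0:ℝ), ∃ β ∈ Set.Ioc (0:ℝ) 1,
    ∀ s ∈ Set.Icc (-h) 0, ∀ x ∈ Set.Icc (-R) R, ∀ y ∈ Set.Icc (-R) R,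
      |w0 s x - w0 s y| ≤ K * |x - y| ^ β

/-- A classical solution of the equation (*):
`u_t(t,x) = u_{xx}(t,x) − u(t,x) + g(u(t−h,x))` for `t > 0`, `x ∈ ℝ`. -/
def SolvesStar (g : ℝ → ℝ) (h : ℝ) (u : ℝ → ℝ → ℝ) : Prop :=
  ContinuousOn (fun p : ℝ × ℝ => u p.1 p.2) {p : ℝ × ℝ | -h ≤ p.1} ∧
  (∀ T : ℝ, ∃ M : ℝ, ∀ t ∈ Set.Icc (-h) T, ∀ x : ℝ, |u t x| ≤ M) ∧
  (∀ t : ℝ, 0 < t → ∀ x : ℝ,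
      DifferentiableAt ℝ (fun τ => u τ x) t ∧
      DifferentiableAt ℝ (fun y => u t y) x ∧
      DifferentiableAt ℝ (deriv (fun y => u t y)) x ∧
      deriv (fun τ => u τ x) t =
        deriv (deriv (fun y => u t y)) x - u t x + g (u (t - h) x)) ∧
  ContinuousOn (fun p : ℝ × ℝ => deriv (fun τ => u τ p.2) p.1) {p : ℝ × ℝ | 0 < p.1} ∧
  ContinuousOn (fun p : ℝ × ℝ => deriv (fun y => u p.1 y) p.2) {p : ℝ × ℝ | 0 < p.1} ∧
  ContinuousOn (fun p : ℝ × ℝ => deriv (deriv (fun y => u p.1 y)) p.2) {p : ℝ × ℝ | 0 < p.1}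

/-- A classical solution of equation (E1):
`w_t = w_{zz} − c w_z − w + g(w(t−h, z−ch))` for `t > 0`, `z ∈ ℝ`. -/
def SolvesE1 (g : ℝ → ℝ) (h c : ℝ) (w : ℝ → ℝ → ℝ) : Prop :=
  ContinuousOn (fun p : ℝ × ℝ => w p.1 p.2) {p : ℝ × ℝ | -h ≤ p.1} ∧
  (∀ T : ℝ, ∃ M : ℝ, ∀ t ∈ Set.Icc (-h) T, ∀ z : ℝ, |w t z| ≤ M) ∧
  (∀ t : ℝ, 0 < t → ∀ z : ℝ,
      DifferentiableAt ℝ (fun τ => w τ z) t ∧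
      DifferentiableAt ℝ (fun y => w t y) z ∧
      DifferentiableAt ℝ (deriv (fun y => w t y)) z ∧
      deriv (fun τ => w τ z) t =
        deriv (deriv (fun y => w t y)) z - c * deriv (fun y => w t y) z
          - w t z + g (w (t - h) (z - c * h))) ∧
  ContinuousOn (fun p : ℝ × ℝ => deriv (fun τ => w τ p.2) p.1) {p : ℝ × ℝ | 0 < p.1} ∧
  ContinuousOn (fun p : ℝ × ℝ => deriv (fun y => w p.1 y) p.2) {p : ℝ × ℝ | 0 < p.1} ∧
  ContinuousOn (fun p : ℝ × ℝ => deriv (deriv (fun y => w p.1 y)) p.2) {p : ℝ × ℝ | 0 < p.1}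

/-- A wavefront with speed `c`: a positive bounded C² solution of the profile equation
with `φ(−∞) = 0`, `φ(+∞) = κ`. -/
def IsWavefront (g : ℝ → ℝ) (h c kap : ℝ) (φ : ℝ → ℝ) : Prop :=
  (∀ z : ℝ, 0 < φ z) ∧ (∃ M : ℝ, ∀ z : ℝ, φ z ≤ M) ∧ ContDiff ℝ 2 φ ∧
  (∀ z : ℝ, deriv (deriv φ) z - c * deriv φ z - φ z + g (φ (z - c * h)) = 0) ∧
  Filter.Tendsto φ Filter.atBot (nhds 0) ∧ Filter.Tendsto φ Filter.atTop (nhds kap)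

/-- A semi-wavefront with speed `c`: as a wavefront, but at `+∞` only
`liminf_{z→+∞} φ(z) > 0` is required. -/
def IsSemiWavefront (g : ℝ → ℝ) (h c : ℝ) (φ : ℝ → ℝ) : Prop :=
  (∀ z : ℝ, 0 < φ z) ∧ (∃ M : ℝ, ∀ z : ℝ, φ z ≤ M) ∧ ContDiff ℝ 2 φ ∧
  (∀ z : ℝ, deriv (deriv φ) z - c * deriv φ z - φ z + g (φ (z - c * h)) = 0) ∧
  Filter.Tendsto φ Filter.atBot (nhds 0) ∧
  (∃ m > (0:ℝ), ∀ᶠ z in Filter.atTop, m ≤ φ z)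

/-- The nonlinear operator `𝒩` associated with (E1). -/
def Nop (g : ℝ → ℝ) (h c : ℝ) (w : ℝ → ℝ → ℝ) (t z : ℝ) : ℝ :=
  deriv (fun τ => w τ z) t - deriv (deriv (fun y => w t y)) z
    + c * deriv (fun y => w t y) z + w t z - g (w (t - h) (z - c * h))

/-- A super-solution of (E1) with break point `zs`. -/
def IsSuperSolution (g : ℝ → ℝ) (h c : ℝ) (w : ℝ → ℝ → ℝ) (zs : ℝ) : Prop :=
  ContinuousOn (fun p : ℝ × ℝ => w p.1 p.2) {p : ℝ × ℝ | -h ≤ p.1} ∧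
  (∀ t : ℝ, -h < t → ∀ z : ℝ, DifferentiableAt ℝ (fun τ => w τ z) t) ∧
  (∀ t : ℝ, -h ≤ t → ∀ z : ℝ, z ≠ zs →
      DifferentiableAt ℝ (fun y => w t y) z ∧
      DifferentiableAt ℝ (deriv (fun y => w t y)) z) ∧
  (∀ t : ℝ, 0 < t → ∀ z : ℝ, z ≠ zs → 0 ≤ Nop g h c w t z) ∧
  (∀ t : ℝ, 0 < t →
      derivWithin (fun y => w t y) (Set.Iic zs) zs
        > derivWithin (fun y => w t y) (Set.Ici zs) zs)

/-- A sub-solution of (E1) with break point `zs` (all inequalities reversed). -/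
def IsSubSolution (g : ℝ → ℝ) (h c : ℝ) (w : ℝ → ℝ → ℝ) (zs : ℝ) : Prop :=
  ContinuousOn (fun p : ℝ × ℝ => w p.1 p.2) {p : ℝ × ℝ | -h ≤ p.1} ∧
  (∀ t : ℝ, -h < t → ∀ z : ℝ, DifferentiableAt ℝ (fun τ => w τ z) t) ∧
  (∀ t : ℝ, -h ≤ t → ∀ z : ℝ, z ≠ zs →
      DifferentiableAt ℝ (fun y => w t y) z ∧
      DifferentiableAt ℝ (deriv (fun y => w t y)) z) ∧
  (∀ t : ℝ, 0 < t → ∀ z : ℝ, z ≠ zs → Nop g h c w t z ≤ 0) ∧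
  (∀ t : ℝ, 0 < t →
      derivWithin (fun y => w t y) (Set.Iic zs) zs
        < derivWithin (fun y => w t y) (Set.Ici zs) zs)

theorem exists_pos_sq_add_abs_mul_lt_one (c : ℝ) : ∃ a : ℝ, 0 < a ∧ a ^ 2 + |c| * a < 1 := by
  refine ⟨1 / (2 + |c|), by positivity, ?_⟩
  have : 0 ≤ |c| := abs_nonneg c
  rw [div_pow, mul_one_div, div_add_div _ _ (by positivity) (by positivity),
    div_lt_one (by positivity)]
  nlinarith [mul_nonneg this this]

/-- `y₁` and `y₂` are the first and second derivatives of `y`, and `y₂` is continuous. -/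
def IsC2With (y y₁ y₂ : ℝ → ℝ) : Prop :=
  (∀ z, HasDerivAt y (y₁ z) z) ∧ (∀ z, HasDerivAt y₁ (y₂ z) z) ∧ Continuous y₂

namespace IsC2With

variable {y y₁ y₂ u u₁ u₂ : ℝ → ℝ}

theorem continuous (hy : IsC2With y y₁ y₂) : Continuous y :=
  continuous_iff_continuousAt.2 fun z => (hy.1 z).continuousAt

theorem continuous₁ (hy : IsC2With y y₁ y₂) : Continuous y₁ :=
  continuous_iff_continuousAt.2 fun z => (hy.2.1 z).continuousAt

theorem deriv_eq (hy : IsC2With y y₁ y₂) : deriv y = y₁ := funext fun z => (hy.1 z).deriv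

theorem deriv_deriv_eq (hy : IsC2With y y₁ y₂) : deriv (deriv y) = y₂ := by
  rw [hy.deriv_eq]
  exact funext fun z => (hy.2.1 z).deriv

theorem contDiff (hy : IsC2With y y₁ y₂) : ContDiff ℝ 2 y := by
  have h1 : ContDiff ℝ 1 y₁ := by
    rw [contDiff_one_iff_deriv]
    refine ⟨fun z => (hy.2.1 z).differentiableAt, ?_⟩
    rw [← hy.deriv_eq, hy.deriv_deriv_eq]
    exact hy.2.2
  rw [show (2 : WithTop ℕ∞) = 1 + 1 by norm_num, contDiff_succ_iff_deriv]
  refine ⟨fun z => (hy.1 z).differentiableAt, by simp, ?_⟩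
  rwa [hy.deriv_eq]

theorem of_contDiff (hy : ContDiff ℝ 2 y) : IsC2With y (deriv y) (deriv (deriv y)) := by
  rw [show (2 : WithTop ℕ∞) = 1 + 1 by norm_num, contDiff_succ_iff_deriv] at hy
  have h1 := contDiff_one_iff_deriv.1 hy.2.2
  exact ⟨fun z => (hy.1 z).hasDerivAt, fun z => (h1.1 z).hasDerivAt, h1.2⟩

theorem add (hy : IsC2With y y₁ y₂) (hu : IsC2With u u₁ u₂) :
    IsC2With (fun z => y z + u z) (fun z => y₁ z + u₁ z) (fun z => y₂ z + u₂ z) :=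
  ⟨fun z => (hy.1 z).add (hu.1 z), fun z => (hy.2.1 z).add (hu.2.1 z), hy.2.2.add hu.2.2⟩

theorem sub (hy : IsC2With y y₁ y₂) (hu : IsC2With u u₁ u₂) :
    IsC2With (fun z => y z - u z) (fun z => y₁ z - u₁ z) (fun z => y₂ z - u₂ z) :=
  ⟨fun z => (hy.1 z).sub (hu.1 z), fun z => (hy.2.1 z).sub (hu.2.1 z), hy.2.2.sub hu.2.2⟩

theorem const_mul (a : ℝ) (hy : IsC2With y y₁ y₂) :
    IsC2With (fun z => a * y z) (fun z => a * y₁ z) (fun z => a * y₂ z) :=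
  ⟨fun z => (hy.1 z).const_mul a, fun z => (hy.2.1 z).const_mul a, continuous_const.mul hy.2.2⟩

theorem comp_add_const (hy : IsC2With y y₁ y₂) (a : ℝ) :
    IsC2With (fun z => y (z + a)) (fun z => y₁ (z + a)) (fun z => y₂ (z + a)) :=
  ⟨fun z => (hy.1 (z + a)).comp_add_const z a, fun z => (hy.2.1 (z + a)).comp_add_const z a,
    hy.2.2.comp (continuous_id.add continuous_const)⟩

theorem const (a : ℝ) : IsC2With (fun _ => a) (fun _ => 0) (fun _ => 0) :=
  ⟨fun z => hasDerivAt_const z a, fun z => hasDerivAt_const z 0, continuous_const⟩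

theorem exp_mul (a : ℝ) : IsC2With (fun z => Real.exp (a * z))
    (fun z => a * Real.exp (a * z)) (fun z => a ^ 2 * Real.exp (a * z)) := by
  have h : ∀ z, HasDerivAt (fun z => Real.exp (a * z)) (a * Real.exp (a * z)) z := fun z => by
    have := ((hasDerivAt_id z).const_mul a).exp
    simpa [mul_comm] using this
  refine ⟨h, fun z => ?_, by fun_prop⟩
  exact ((h z).const_mul a).congr_deriv (by ring)

theorem strictMono (hy : IsC2With y y₁ y₂) (hpos : ∀ z, 0 < y₁ z) : StrictMono y :=
  strictMono_of_deriv_pos fun z => by rw [hy.deriv_eq]; exact hpos z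

theorem deriv_two_nonneg_of_isLocalMin (hy : IsC2With y y₁ y₂) {z : ℝ} (hz : IsLocalMin y z) :
    0 ≤ y₂ z := by
  by_contra! hneg
  have h1 : deriv y z = 0 := hz.deriv_eq_zero
  have hmax : IsLocalMax y z :=
    isLocalMax_of_deriv_deriv_neg (by rw [hy.deriv_deriv_eq]; exact hneg) h1
      hy.continuous.continuousAt
  have hconst : y =ᶠ[nhds z] fun _ => y z := by
    filter_upwards [hz, hmax] with x h1 h2 using le_antisymm h2 h1
  have h2 : deriv (deriv y) z = 0 := by
    rw [hconst.deriv.deriv_eq]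
    simp
  rw [hy.deriv_deriv_eq] at h2
  exact hneg.ne h2

/-- Maximum principle on the line for functions bounded from below. -/
theorem nonneg_of_linear_ineq {c M : ℝ} (hy : IsC2With y y₁ y₂) (hM : ∀ z, -M ≤ y z)
    (hle : ∀ z, y₂ z - c * y₁ z - y z ≤ 0) (z₀ : ℝ) : 0 ≤ y z₀ := by
  obtain ⟨a, ha0, hac⟩ := exists_pos_sq_add_abs_mul_lt_one c
  have key : ∀ ε > 0, 0 ≤ y z₀ + ε * (Real.exp (a * z₀) + Real.exp (-a * z₀)) := by
    intro ε hε
    have hu := hy.add (((exp_mul a).add (exp_mul (-a))).const_mul ε)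
    have htend : Tendsto (fun z => y z + ε * (Real.exp (a * z) + Real.exp (-a * z)))
        (cocompact ℝ) atTop := by
      rw [cocompact_eq_atBot_atTop]
      refine Tendsto.sup ?_ ?_
      · have h1 : Tendsto (fun z => -M + ε * Real.exp (-a * z)) atBot atTop :=
          tendsto_atTop_add_const_left _ _ ((Real.tendsto_exp_atTop.comp
            (tendsto_id.const_mul_atBot_of_neg (by linarith))).const_mul_atTop hε)
        refine tendsto_atTop_mono (fun z => ?_) h1
        nlinarith [hM z, Real.exp_pos (a * z)]
      · have h1 : Tendsto (fun z => -M + ε * Real.exp (a * z)) atTop atTop :=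
          tendsto_atTop_add_const_left _ _ ((Real.tendsto_exp_atTop.comp
            (tendsto_id.const_mul_atTop ha0)).const_mul_atTop hε)
        refine tendsto_atTop_mono (fun z => ?_) h1
        nlinarith [hM z, Real.exp_pos (-a * z)]
    obtain ⟨x, hx⟩ := hu.continuous.exists_forall_le htend
    have hloc : IsLocalMin (fun z => y z + ε * (Real.exp (a * z) + Real.exp (-a * z))) x :=
      Filter.Eventually.of_forall hx
    have h2 := hu.deriv_two_nonneg_of_isLocalMin hloc
    have h1 := hloc.hasDerivAt_eq_zero (hu.1 x)
    have h0 := hle x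
    refine le_trans ?_ (hx z₀)
    have e1 := Real.exp_pos (a * x)
    have e2 := Real.exp_pos (-a * x)
    have b1 : a ^ 2 - c * a - 1 ≤ 0 := by nlinarith [neg_abs_le c]
    have b2 : a ^ 2 + c * a - 1 ≤ 0 := by nlinarith [le_abs_self c]
    have h3 : ε * ((a ^ 2 - c * a - 1) * Real.exp (a * x)
        + (a ^ 2 + c * a - 1) * Real.exp (-a * x)) ≤ 0 :=
      mul_nonpos_of_nonneg_of_nonpos hε.le (by nlinarith)
    have h1' : c * (y₁ x + ε * (a * Real.exp (a * x) + -a * Real.exp (-a * x))) = 0 := by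
      exact mul_eq_zero_of_right c h1
    nlinarith
  have hlim : Tendsto (fun ε : ℝ => y z₀ + ε * (Real.exp (a * z₀) + Real.exp (-a * z₀)))
      (nhdsWithin 0 (Ioi 0)) (nhds (y z₀ + 0 * (Real.exp (a * z₀) + Real.exp (-a * z₀)))) :=
    (tendsto_nhdsWithin_of_tendsto_nhds (Continuous.tendsto (by fun_prop) _))
  rw [zero_mul, add_zero] at hlim
  exact ge_of_tendsto hlim (by filter_upwards [self_mem_nhdsWithin] with ε hε using key ε hε)

end IsC2With

/-- The exponential average `∫₀^∞ μ e^{-μt} F(z+t) dt` of `F` over `[z, ∞)`. -/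
def expAvg (μ : ℝ) (F : ℝ → ℝ) (z : ℝ) : ℝ :=
  Real.exp (μ * z) * ∫ s in Ioi z, μ * Real.exp (-μ * s) * F s

section expAvg

variable {μ M : ℝ} {F : ℝ → ℝ}

theorem integrableOn_expAvg (hμ : 0 < μ) (hF : Continuous F) (hM : ∀ z, |F z| ≤ M) (z : ℝ) :
    MeasureTheory.IntegrableOn (fun s => μ * Real.exp (-μ * s) * F s) (Ioi z) := by
  have h := (integrableOn_exp_mul_Ioi (a := -μ) (by linarith) z).const_mul μ
  exact h.mul_bdd (c := M) hF.aestronglyMeasurable (Eventually.of_forall hM)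

theorem hasDerivAt_expAvg (hμ : 0 < μ) (hF : Continuous F) (hM : ∀ z, |F z| ≤ M) (z : ℝ) :
    HasDerivAt (expAvg μ F) (μ * (expAvg μ F z - F z)) z := by
  have heq : expAvg μ F = fun z => Real.exp (μ * z) *
      ((∫ s in Ioi 0, μ * Real.exp (-μ * s) * F s) -
        ∫ s in (0 : ℝ)..z, μ * Real.exp (-μ * s) * F s) := by
    funext z
    rw [← intervalIntegral.integral_interval_add_Ioi (integrableOn_expAvg hμ hF hM 0)
      (integrableOn_expAvg hμ hF hM z), add_sub_cancel_left, expAvg]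
  have hc : Continuous fun s => μ * Real.exp (-μ * s) * F s := by fun_prop
  have h1 := (hc.integral_hasStrictDerivAt 0 z).hasDerivAt
  have h2 := ((IsC2With.exp_mul μ).1 z).mul
    (h1.const_sub (∫ s in Ioi 0, μ * Real.exp (-μ * s) * F s))
  have h3 := congrFun heq z
  rw [h3, heq]
  refine h2.congr_deriv ?_
  have h4 : Real.exp (μ * z) * Real.exp (-μ * z) = 1 := by
    rw [← Real.exp_add]; simp
  linear_combination (-μ * F z) * h4

theorem expAvg_neg : expAvg μ (fun x => -F x) = fun z => -expAvg μ F z := by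
  funext z
  simp [expAvg, MeasureTheory.integral_neg]

theorem le_expAvg (hμ : 0 < μ) (hF : Continuous F) (hM : ∀ z, |F z| ≤ M) {z m : ℝ}
    (hm : ∀ s, z < s → m ≤ F s) : m ≤ expAvg μ F z := by
  have h1 : ∫ s in Ioi z, μ * Real.exp (-μ * s) * m ≤
      ∫ s in Ioi z, μ * Real.exp (-μ * s) * F s := by
    refine MeasureTheory.setIntegral_mono_on
      (integrableOn_expAvg hμ continuous_const (M := |m|) (fun _ => le_rfl) z)
      (integrableOn_expAvg hμ hF hM z) measurableSet_Ioi fun s hs => ?_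
    have := Real.exp_pos (-μ * s)
    exact mul_le_mul_of_nonneg_left (hm s hs) (by positivity)
  have h2 : ∫ s in Ioi z, μ * Real.exp (-μ * s) * m = Real.exp (-μ * z) * m := by
    rw [MeasureTheory.integral_mul_const, MeasureTheory.integral_const_mul,
      integral_exp_mul_Ioi (by linarith)]
    field_simp
  rw [h2] at h1
  have h3 := mul_le_mul_of_nonneg_left h1 (Real.exp_pos (μ * z)).le
  rw [← mul_assoc, ← Real.exp_add] at h3
  simpa [expAvg] using h3

theorem expAvg_le (hμ : 0 < μ) (hF : Continuous F) (hM : ∀ z, |F z| ≤ M) {z m : ℝ}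
    (hm : ∀ s, z < s → F s ≤ m) : expAvg μ F z ≤ m := by
  have := le_expAvg (F := fun x => -F x) (m := -m) hμ hF.neg (by simpa using hM)
    (fun s hs => neg_le_neg (hm s hs))
  rw [expAvg_neg] at this
  linarith

theorem lt_expAvg (hμ : 0 < μ) (hF : Continuous F) (hM : ∀ z, |F z| ≤ M) (hmono : Monotone F)
    {z b : ℝ} (hzb : F z < F b) : F z < expAvg μ F z := by
  have hlt : z < b := hmono.reflect_lt hzb
  have hd : ∀ x, HasDerivAt (fun x => Real.exp (-μ * x) * (expAvg μ F x - F z))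
      (-μ * Real.exp (-μ * x) * (F x - F z)) x := fun x =>
    (((IsC2With.exp_mul (-μ)).1 x).mul
      ((hasDerivAt_expAvg hμ hF hM x).sub_const (F z))).congr_deriv (by ring)
  have hanti : AntitoneOn (fun x => Real.exp (-μ * x) * (expAvg μ F x - F z)) (Ici z) := by
    refine antitoneOn_of_deriv_nonpos (convex_Ici z)
      (fun x _ => (hd x).continuousAt.continuousWithinAt)
      (fun x _ => (hd x).differentiableAt.differentiableWithinAt) fun x hx => ?_
    rw [interior_Ici] at hx
    rw [(hd x).deriv]
    have := mul_nonneg (mul_pos hμ (Real.exp_pos (-μ * x))).le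
      (sub_nonneg.2 (hmono (le_of_lt hx)))
    linarith
  have h1 := hanti self_mem_Ici hlt.le hlt.le
  have h2 : F b ≤ expAvg μ F b := le_expAvg hμ hF hM fun s hs => hmono hs.le
  have h3 : 0 < Real.exp (-μ * z) * (expAvg μ F z - F z) :=
    lt_of_lt_of_le (mul_pos (Real.exp_pos _) (by linarith)) h1
  have := (mul_pos_iff_of_pos_left (Real.exp_pos _)).1 h3
  linarith

end expAvg

/-- For a bounded nonconstant monotone source `F`, the equation `y₂ - c y₁ - y + F = 0` has a
bounded strictly increasing solution. -/
theorem exists_increasing_solution {c M : ℝ} {F : ℝ → ℝ} (hF : Continuous F) (hmono : Monotone F)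
    (h0 : ∀ z, 0 ≤ F z) (hM : ∀ z, F z ≤ M) {a b : ℝ} (hab : F a < F b) :
    ∃ y y₁ y₂ : ℝ → ℝ, IsC2With y y₁ y₂ ∧ (∀ z, 0 ≤ y z) ∧ (∀ z, y z ≤ M) ∧ (∀ z, 0 < y₁ z) ∧
      ∀ z, y₂ z - c * y₁ z - y z + F z = 0 := by
  obtain ⟨μ, ν, hμ, hν, hsub, hmul⟩ : ∃ μ ν : ℝ, 0 < μ ∧ 0 < ν ∧ μ - ν = c ∧ μ * ν = 1 := by
    have h1 := Real.sq_sqrt (show 0 ≤ c ^ 2 + 4 by positivity)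
    have h2 : |c| < √(c ^ 2 + 4) := Real.lt_sqrt_of_sq_lt (by rw [sq_abs]; linarith)
    have h3 := abs_lt.1 h2
    refine ⟨(c + √(c ^ 2 + 4)) / 2, (-c + √(c ^ 2 + 4)) / 2, by linarith, by linarith, by ring, ?_⟩
    linear_combination h1 / 4
  have hFM : ∀ z, |F z| ≤ M := fun z => abs_le.2 ⟨by linarith [h0 z, hM z], hM z⟩
  set G : ℝ → ℝ := fun x => -F (-x) with hG
  have hGc : Continuous G := by fun_prop
  have hGM : ∀ z, |G z| ≤ M := fun z => by simpa [hG] using hFM (-z)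
  have hGmono : Monotone G := fun x y hxy => neg_le_neg (hmono (neg_le_neg hxy))
  set R := expAvg μ F with hR
  set L : ℝ → ℝ := fun z => -expAvg ν G (-z) with hL
  have hRd : ∀ z, HasDerivAt R (μ * (R z - F z)) z := hasDerivAt_expAvg hμ hF hFM
  have hLd : ∀ z, HasDerivAt L (-ν * (L z - F z)) z := fun z => by
    have h1 := ((hasDerivAt_expAvg hν hGc hGM (-z)).scomp z (hasDerivAt_neg z)).neg
    refine h1.congr_deriv ?_
    simp only [hL, hG, neg_neg, smul_eq_mul]
    ring
  have hFR : ∀ z, F z ≤ R z := fun z => le_expAvg hμ hF hFM fun s hs => hmono hs.le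
  have hLF : ∀ z, L z ≤ F z := fun z => by
    have : G (-z) ≤ expAvg ν G (-z) := le_expAvg hν hGc hGM fun s hs => hGmono hs.le
    simp only [hG, neg_neg] at this
    simp only [hL]
    linarith
  have hRM : ∀ z, R z ≤ M := fun z => expAvg_le hμ hF hFM fun s _ => hM s
  have hL0 : ∀ z, 0 ≤ L z := fun z => by
    have : expAvg ν G (-z) ≤ 0 := expAvg_le hν hGc hGM fun s _ => by simpa [hG] using h0 (-s)
    simp only [hL]
    linarith
  have hs : 0 < μ + ν := by positivity
  have hRc : Continuous R := continuous_iff_continuousAt.2 fun z => (hRd z).continuousAt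
  have hLc : Continuous L := continuous_iff_continuousAt.2 fun z => (hLd z).continuousAt
  refine ⟨fun z => (μ * L z + ν * R z) / (μ + ν), fun z => (R z - L z) / (μ + ν),
    fun z => (μ * (R z - F z) - -ν * (L z - F z)) / (μ + ν), ⟨fun z => ?_, fun z => ?_, ?_⟩,
    fun z => ?_, fun z => ?_, fun z => ?_, fun z => ?_⟩
  · refine ((((hLd z).const_mul μ).add ((hRd z).const_mul ν)).div_const (μ + ν)).congr_deriv ?_
    congr 1
    linear_combination (R z - L z) * hmul
  · exact ((hRd z).sub (hLd z)).div_const (μ + ν)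
  · fun_prop
  · have := hL0 z
    have := (h0 z).trans (hFR z)
    positivity
  · rw [div_le_iff₀ hs]
    nlinarith [mul_le_mul_of_nonneg_left ((hLF z).trans (hM z)) hμ.le,
      mul_le_mul_of_nonneg_left (hRM z) hν.le]
  · refine div_pos (sub_pos.2 ?_) hs
    rcases lt_or_ge (F z) (F b) with h | h
    · exact (hLF z).trans_lt (lt_expAvg hμ hF hFM hmono h)
    · refine lt_of_lt_of_le ?_ (hFR z)
      have := lt_expAvg (z := -z) (b := -a) hν hGc hGM hGmono (by
        simp only [hG, neg_neg]; linarith)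
      simp only [hG, neg_neg] at this
      simp only [hL]
      linarith
  · rw [← hsub]
    field_simp
    ring

theorem eventually_sub_lt_of_hasDerivAt {g : ℝ → ℝ} {a d r : ℝ} (hg : HasDerivAt g d a)
    (hdr : d < r) : ∀ᶠ u in nhdsWithin a (Ioi a), g u - g a < r * (u - a) := by
  have h := (hasDerivWithinAt_iff_tendsto_slope' (lt_irrefl a)).1 (hg.hasDerivWithinAt (s := Ioi a))
  filter_upwards [h.eventually_lt_const hdr, self_mem_nhdsWithin] with u hu hua
  rwa [slope_def_field, div_lt_iff₀ (sub_pos.2 hua)] at hu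

theorem eventually_lt_sub_of_hasDerivAt {g : ℝ → ℝ} {a d r : ℝ} (hg : HasDerivAt g d a)
    (hdr : r < d) : ∀ᶠ u in nhdsWithin a (Ioi a), r * (u - a) < g u - g a := by
  filter_upwards [eventually_sub_lt_of_hasDerivAt hg.neg (neg_lt_neg hdr)] with u hu
  simp only [Pi.neg_apply] at hu
  linarith

namespace HypH

variable {g : ℝ → ℝ} {kap del0 Lg : ℝ}

theorem map_zero (hH : HypH g kap del0 Lg) : g 0 = 0 :=
  (hH.fixed_points 0 le_rfl).2 (Or.inl rfl)

theorem map_kap (hH : HypH g kap del0 Lg) : g kap = kap :=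
  (hH.fixed_points kap hH.kap_pos.le).2 (Or.inr rfl)

theorem differentiableAt_of_mem (hH : HypH g kap del0 Lg) {x : ℝ} (hx : x ∈ Ioo (-del0) del0) :
    DifferentiableAt ℝ g x :=
  (hH.smooth0.differentiableOn one_ne_zero).differentiableAt (Ioo_mem_nhds hx.1 hx.2)

theorem differentiableAt_of_mem_kap (hH : HypH g kap del0 Lg) {x : ℝ}
    (hx : x ∈ Ioo (kap - del0) (kap + del0)) : DifferentiableAt ℝ g x :=
  (hH.smooth_kap.differentiableOn one_ne_zero).differentiableAt (Ioo_mem_nhds hx.1 hx.2)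

theorem hasDerivAt_zero (hH : HypH g kap del0 Lg) : HasDerivAt g (deriv g 0) 0 :=
  (hH.differentiableAt_of_mem ⟨neg_lt_zero.2 hH.del0_pos, hH.del0_pos⟩).hasDerivAt

theorem hasDerivAt_kap (hH : HypH g kap del0 Lg) : HasDerivAt g (deriv g kap) kap :=
  (hH.differentiableAt_of_mem_kap
    ⟨by linarith [hH.del0_pos], by linarith [hH.del0_pos]⟩).hasDerivAt

theorem exists_lt_mul (hH : HypH g kap del0 Lg) {r : ℝ} (hr : deriv g 0 < r) :
    ∃ δ > 0, ∀ u, 0 < u → u < δ → g u < r * u := by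
  have h := eventually_sub_lt_of_hasDerivAt hH.hasDerivAt_zero hr
  obtain ⟨δ, hδ, hsub⟩ := mem_nhdsGT_iff_exists_Ioo_subset.1 h
  refine ⟨δ, hδ, fun u hu huδ => ?_⟩
  have := hsub ⟨hu, huδ⟩
  simpa [hH.map_zero] using this

theorem le_map (hH : HypH g kap del0 Lg) {x : ℝ} (hx0 : 0 ≤ x) (hxk : x ≤ kap) : x ≤ g x := by
  by_contra! hlt
  have hx0' : 0 < x := lt_of_le_of_ne hx0 fun h => by
    rw [← h, hH.map_zero] at hlt
    exact hlt.false
  obtain ⟨u, hu, hux⟩ := ((eventually_lt_sub_of_hasDerivAt hH.hasDerivAt_zero hH.deriv0_gt).and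
    (Ioo_mem_nhdsGT hx0')).exists
  rw [hH.map_zero] at hu
  obtain ⟨v, hv, hgv⟩ := intermediate_value_Icc' hux.2.le (f := fun y => g y - y)
    (hH.cont.sub continuous_id).continuousOn
    (show (0 : ℝ) ∈ Icc _ _ from ⟨by linarith, by linarith⟩)
  have hgv' : g v = v := sub_eq_zero.1 hgv
  rcases (hH.fixed_points v (hux.1.le.trans hv.1)).1 hgv' with h | h
  · linarith [hux.1, hv.1]
  · have : x = kap := le_antisymm hxk (h ▸ hv.2)
    rw [this, hH.map_kap] at hlt
    exact hlt.false

theorem map_le (hH : HypH g kap del0 Lg) {x : ℝ} (hxk : kap ≤ x) : g x ≤ x := by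
  by_contra! hlt
  have hxk' : kap < x := lt_of_le_of_ne hxk fun h => by
    rw [← h, hH.map_kap] at hlt
    exact hlt.false
  obtain ⟨u, hu, hux⟩ := ((eventually_sub_lt_of_hasDerivAt hH.hasDerivAt_kap hH.deriv_kap_lt).and
    (Ioo_mem_nhdsGT hxk')).exists
  rw [hH.map_kap] at hu
  obtain ⟨v, hv, hgv⟩ := intermediate_value_Icc hux.2.le (f := fun y => g y - y)
    (hH.cont.sub continuous_id).continuousOn
    (show (0 : ℝ) ∈ Icc _ _ from ⟨by linarith, by linarith⟩)
  have hgv' : g v = v := sub_eq_zero.1 hgv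
  have hk := hH.kap_pos
  rcases (hH.fixed_points v (by linarith [hux.1, hv.1])).1 hgv' with h | h <;>
    linarith [hux.1, hv.1]

/-- Just below `κ` the increments of `g` do not exceed those of the identity. -/
theorem exists_increment_le (hH : HypH g kap del0 Lg) :
    ∃ η > 0, ∀ w ∈ Icc (kap - η) kap, ∀ x, 0 ≤ x → g (w + x) - g w ≤ x := by
  have hd0 := hH.del0_pos
  have hcont : ContinuousAt (deriv g) kap :=
    (hH.smooth_kap.continuousOn_deriv_of_isOpen isOpen_Ioo le_rfl).continuousAt
      (Ioo_mem_nhds (by linarith) (by linarith))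
  obtain ⟨d, hd, hball⟩ := Metric.eventually_nhds_iff.1 (hcont.eventually_lt_const hH.deriv_kap_lt)
  obtain ⟨η, hη, hηd, hηdel, hηk⟩ : ∃ η > 0, η < d ∧ η < del0 ∧ η < kap := by
    obtain ⟨η, h0, h1⟩ := exists_between (lt_min hd (lt_min hd0 hH.kap_pos))
    simp only [lt_min_iff] at h1
    exact ⟨η, h0, h1⟩
  refine ⟨η, hη, fun w hw x hx => ?_⟩
  have hanti : AntitoneOn (fun y => g y - y) (Icc (kap - η) kap) := by
    have hdiff : ∀ y ∈ Icc (kap - η) kap, HasDerivAt (fun y => g y - y) (deriv g y - 1) y :=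
      fun y hy => (hH.differentiableAt_of_mem_kap
        ⟨by linarith [hy.1], by linarith [hy.2]⟩).hasDerivAt.sub (hasDerivAt_id y)
    refine antitoneOn_of_deriv_nonpos (convex_Icc _ _)
      (fun y hy => (hdiff y hy).continuousAt.continuousWithinAt)
      (fun y hy => (hdiff y (interior_subset hy)).differentiableAt.differentiableWithinAt)
      fun y hy => ?_
    have hy' := interior_subset hy
    rw [(hdiff y hy').deriv]
    have : deriv g y < 1 := hball (by
      rw [Real.dist_eq, abs_lt]
      constructor <;> linarith [hy'.1, hy'.2])
    linarith
  rcases le_total (w + x) kap with h | h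
  · have := hanti hw ⟨by linarith [hw.1], h⟩ (by linarith : w ≤ w + x)
    simp only at this
    linarith
  · linarith [hH.map_le h, hH.le_map (by linarith [hw.1] : 0 ≤ w) hw.2]

theorem exists_linearization_bound (hH : HypH g kap del0 Lg) :
    ∃ C > 0, ∃ θ ∈ Ioc (0 : ℝ) 1, ∀ v x, 0 ≤ v → 0 ≤ x → v + x < del0 →
      g (v + x) - g v - deriv g 0 * x ≤ C * (v + x) ^ θ * x := by
  obtain ⟨C, hC, θ, hθ, hb⟩ := hH.holder
  refine ⟨C, hC, θ, hθ, fun v x hv hx hlt => ?_⟩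
  rcases hx.eq_or_lt with rfl | hx
  · simp
  have hd : ∀ y ∈ Icc v (v + x), DifferentiableAt ℝ g y := fun y hy =>
    hH.differentiableAt_of_mem ⟨by linarith [hy.1], by linarith [hy.2]⟩
  obtain ⟨ξ, hξ, heq⟩ := exists_deriv_eq_slope g (by linarith : v < v + x)
    (fun y hy => (hd y hy).continuousAt.continuousWithinAt)
    (fun y hy => (hd y (Ioo_subset_Icc_self hy)).differentiableWithinAt)
  rw [add_sub_cancel_left, eq_div_iff hx.ne'] at heq
  have h1 := (le_abs_self _).trans (hb ξ ⟨by linarith [hξ.1], by linarith [hξ.2]⟩)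
  have h2 : ξ ^ θ ≤ (v + x) ^ θ :=
    Real.rpow_le_rpow (by linarith [hξ.1]) hξ.2.le hθ.1.le
  have h3 : C * ξ ^ θ ≤ C * (v + x) ^ θ := mul_le_mul_of_nonneg_left h2 hC.le
  nlinarith

end HypH

/-- The largest nondecreasing minorant `z ↦ inf_{y ≥ z} φ(y)` of `φ`. -/
def monoMinorant (φ : ℝ → ℝ) (z : ℝ) : ℝ := ⨅ t : ℝ, φ (z + |t|)

section monoMinorant

variable {φ : ℝ → ℝ}

theorem bddBelow_range_add_abs (h0 : ∀ z, 0 ≤ φ z) (z : ℝ) :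
    BddBelow (range fun t : ℝ => φ (z + |t|)) :=
  ⟨0, by rintro _ ⟨t, rfl⟩; exact h0 _⟩

theorem monoMinorant_le (h0 : ∀ z, 0 ≤ φ z) (z : ℝ) {s : ℝ} (hs : 0 ≤ s) :
    monoMinorant φ z ≤ φ (z + s) := by
  have := ciInf_le (bddBelow_range_add_abs h0 z) s
  rwa [abs_of_nonneg hs] at this

theorem le_monoMinorant {z m : ℝ} (hm : ∀ y, z ≤ y → m ≤ φ y) : m ≤ monoMinorant φ z :=
  le_ciInf fun t => hm _ (by linarith [abs_nonneg t])

theorem monotone_monoMinorant (h0 : ∀ z, 0 ≤ φ z) : Monotone (monoMinorant φ) := by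
  intro x y hxy
  refine le_monoMinorant fun t ht => ?_
  have := monoMinorant_le h0 x (s := t - x) (by linarith)
  rwa [add_sub_cancel] at this

theorem continuous_monoMinorant (h0 : ∀ z, 0 ≤ φ z) (hc : Continuous φ) {l : ℝ}
    (hl : Tendsto φ atTop (nhds l)) : Continuous (monoMinorant φ) := by
  refine continuous_iff_continuousAt.2 fun z => ?_
  have hunif : UniformContinuous fun t : ℝ => φ (z - 1 + |t|) := by
    refine Continuous.uniformContinuous_of_tendsto_cocompact (x := l) (by fun_prop) ?_
    exact hl.comp (tendsto_atTop_add_const_left _ _ tendsto_norm_cocompact_atTop)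
  rw [Metric.continuousAt_iff]
  intro ε hε
  obtain ⟨δ, hδ, hd⟩ := Metric.uniformContinuous_iff.1 hunif (ε / 2) (half_pos hε)
  have key : ∀ x y : ℝ, z - 1 ≤ x → z - 1 ≤ y → |x - y| < δ →
      monoMinorant φ x - ε / 2 ≤ monoMinorant φ y := by
    intro x y hx hy hxy
    refine le_ciInf fun t => ?_
    have h1 := monoMinorant_le h0 x (abs_nonneg t)
    have h2 := @hd (x - (z - 1) + |t|) (y - (z - 1) + |t|) (by
      rw [Real.dist_eq]; convert hxy using 2; ring)
    rw [Real.dist_eq, abs_of_nonneg (by linarith [abs_nonneg t] : 0 ≤ x - (z - 1) + |t|),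
      abs_of_nonneg (by linarith [abs_nonneg t] : 0 ≤ y - (z - 1) + |t|)] at h2
    have h3 := (abs_lt.1 h2).2
    rw [show z - 1 + (x - (z - 1) + |t|) = x + |t| by ring,
      show z - 1 + (y - (z - 1) + |t|) = y + |t| by ring] at h3
    linarith
  refine ⟨min δ 1, lt_min hδ one_pos, fun x hx => ?_⟩
  rw [Real.dist_eq, lt_min_iff] at hx
  have h1 := abs_lt.1 hx.2
  have hx' : |z - x| < δ := by rw [abs_sub_comm]; exact hx.1
  have h2 := key x z (by linarith) (by linarith) hx.1
  have h3 := key z x (by linarith) (by linarith) hx'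
  rw [Real.dist_eq, abs_lt]
  constructor <;> linarith

end monoMinorant

/-- A wavefront, monotone or not, dominates a strictly increasing super-solution profile. -/
theorem IsWavefront.exists_increasing_profile {g : ℝ → ℝ} {kap del0 Lg h c : ℝ} {φ : ℝ → ℝ}
    (hH : HypH g kap del0 Lg) (hmono : StrictMono g) (hφ : IsWavefront g h c kap φ) :
    ∃ f y y₁ y₂ : ℝ → ℝ, Continuous f ∧ Monotone f ∧ (∀ z, 0 ≤ f z) ∧ (∀ z, f z ≤ kap) ∧
      Tendsto f atTop (nhds kap) ∧ Tendsto f atBot (nhds 0) ∧ IsC2With y y₁ y₂ ∧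
      (∀ z, 0 ≤ y z) ∧ (∀ z, y z ≤ f z) ∧ (∀ z, 0 < y₁ z) ∧
      ∀ z, y₂ z - c * y₁ z - y z + g (f (z - c * h)) = 0 := by
  obtain ⟨hpos, ⟨M, hM⟩, hC2, heq, hbot, htop⟩ := hφ
  have h0 : ∀ z, 0 ≤ φ z := fun z => (hpos z).le
  set f := monoMinorant φ with hf
  have hfmono : Monotone f := monotone_monoMinorant h0
  have hf0 : ∀ z, 0 ≤ f z := fun z => le_monoMinorant fun y _ => h0 y
  have hfφ : ∀ z, f z ≤ φ z := fun z => by simpa using monoMinorant_le h0 z le_rfl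
  have hfcont : Continuous f := continuous_monoMinorant h0 hC2.continuous htop
  have hfk : ∀ z, f z ≤ kap := fun z =>
    ge_of_tendsto htop (by
      filter_upwards [eventually_ge_atTop z] with y hy using (hfmono hy).trans (hfφ y))
  have hftop : Tendsto f atTop (nhds kap) := by
    refine tendsto_order.2 ⟨fun m hm => ?_, fun m hm => Eventually.of_forall fun z =>
      (hfk z).trans_lt hm⟩
    obtain ⟨m', hm', hm'k⟩ := exists_between hm
    obtain ⟨Z, hZ⟩ := eventually_atTop.1 (htop.eventually_const_lt hm'k)
    filter_upwards [eventually_ge_atTop Z] with z hz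
    exact hm'.trans_le (le_monoMinorant fun y hy => (hZ y (hz.trans hy)).le)
  have hfbot : Tendsto f atBot (nhds 0) :=
    tendsto_of_tendsto_of_tendsto_of_le_of_le tendsto_const_nhds hbot hf0 hfφ
  obtain ⟨a, ha⟩ := (hfbot.eventually_lt_const (half_pos hH.kap_pos)).exists
  obtain ⟨b, hb⟩ := (hftop.eventually_const_lt (half_lt_self hH.kap_pos)).exists
  obtain ⟨y, y₁, y₂, hy, hy0, hyM, hy1, hyeq⟩ := exists_increasing_solution (c := c) (M := kap)
    (F := fun z => g (f (z - c * h))) (a := a + c * h) (b := b + c * h)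
    (hH.cont.comp (hfcont.comp (by fun_prop)))
    (fun x y hxy => hmono.monotone (hfmono (by linarith)))
    (fun z => hH.nonneg _ (hf0 _))
    (fun z => by simpa [hH.map_kap] using hmono.monotone (hfk (z - c * h)))
    (by simpa using hmono (ha.trans hb))
  refine ⟨f, y, y₁, y₂, hfcont, hfmono, hf0, hfk, hftop, hfbot, hy, hy0, fun z => ?_, hy1, hyeq⟩
  refine le_ciInf fun s => ?_
  have hD := (((IsC2With.of_contDiff hC2).comp_add_const |s|).sub hy)
  have := hD.nonneg_of_linear_ineq (c := c) (M := kap)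
    (fun z => by linarith [h0 (z + |s|), hyM z]) (fun z => ?_) z
  · linarith
  · have e1 := heq (z + |s|)
    have e2 := hyeq z
    have e3 : g (f (z - c * h)) ≤ g (φ (z + |s| - c * h)) := hmono.monotone (by
      have := monoMinorant_le h0 (z - c * h) (abs_nonneg s)
      rwa [show z - c * h + |s| = z + |s| - c * h by ring] at this)
    linarith

theorem IsC2With.exists_le_of_source_ge {c l m Z : ℝ} {F y y₁ y₂ : ℝ → ℝ} (hy : IsC2With y y₁ y₂)
    (hy0 : ∀ z, 0 ≤ y z) (hF0 : ∀ z, 0 ≤ F z) (heq : ∀ z, y₂ z - c * y₁ z - y z + F z = 0)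
    (hlm : l < m) (hF : ∀ z, Z ≤ z → m ≤ F z) : ∃ Z', ∀ z, Z' ≤ z → l ≤ y z := by
  obtain ⟨a, ha0, hac⟩ := exists_pos_sq_add_abs_mul_lt_one c
  have hca : 0 < 1 - a ^ 2 - c * a := by nlinarith [le_abs_self c]
  set C := |m| * Real.exp (a * Z) / (1 - a ^ 2 - c * a) with hC
  have hC0 : 0 ≤ C := by positivity
  have hCeq : C * (1 - a ^ 2 - c * a) = |m| * Real.exp (a * Z) := by
    rw [hC, div_mul_cancel₀ _ hca.ne']
  have hD := (hy.sub (IsC2With.const m)).add ((IsC2With.exp_mul (-a)).const_mul C)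
  have hlow : ∀ z, 0 ≤ y z - m + C * Real.exp (-a * z) := by
    refine hD.nonneg_of_linear_ineq (c := c) (M := |m|) (fun z => ?_) (fun z => ?_)
    · have := hy0 z
      have : 0 ≤ C * Real.exp (-a * z) := by positivity
      linarith [le_abs_self m]
    · have h1 := heq z
      have hexp := Real.exp_pos (-a * z)
      have h2 : m - F z ≤ C * (1 - a ^ 2 - c * a) * Real.exp (-a * z) := by
        rw [hCeq]
        rcases le_total Z z with h | h
        · have : 0 ≤ |m| * Real.exp (a * Z) * Real.exp (-a * z) := by positivity
          linarith [hF z h]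
        · have h3 : 1 ≤ Real.exp (a * Z) * Real.exp (-a * z) := by
            rw [← Real.exp_add, Real.one_le_exp_iff]
            nlinarith
          have h4 := mul_le_mul_of_nonneg_left h3 (abs_nonneg m)
          linarith [hF0 z, le_abs_self m]
      linarith
  have hlim : Tendsto (fun z => C * Real.exp (-a * z)) atTop (nhds (C * 0)) :=
    (Real.tendsto_exp_atBot.comp (tendsto_id.const_mul_atTop_of_neg (by linarith))).const_mul C
  rw [mul_zero] at hlim
  obtain ⟨Z', hZ'⟩ := eventually_atTop.1 (hlim.eventually_lt_const (sub_pos.2 hlm))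
  exact ⟨Z', fun z hz => by linarith [hZ' z hz, hlow z]⟩

/-- A wavefront of speed smaller than `c` yields a strict super-solution profile of speed `c`
connecting `0` and `κ` and decaying like `e^{λz}` at `-∞` whenever `χ₀(λ) < 0`. -/
theorem exists_bounded_supersolution {g : ℝ → ℝ} {kap del0 Lg h c c' lam : ℝ} {φ : ℝ → ℝ}
    (hH : HypH g kap del0 Lg) (hmono : StrictMono g) (hh : 0 < h) (hc' : c' < c)
    (hφ : IsWavefront g h c' kap φ) (hlam : 0 < lam) (hchi : chi (deriv g 0) c h lam < 0) :
    ∃ A > 0, ∃ W W₁ W₂ : ℝ → ℝ, IsC2With W W₁ W₂ ∧ (∀ z, 0 < W z) ∧ (∀ z, W z ≤ kap) ∧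
      (∀ z, W z ≤ A * Real.exp (lam * z)) ∧ (∀ z, 0 < W₁ z) ∧
      (∀ m < kap, ∃ Z, ∀ z, Z ≤ z → m ≤ W z) ∧
      ∀ z, W₂ z - c * W₁ z - W z + g (W (z - c * h)) < 0 := by
  have hk := hH.kap_pos
  obtain ⟨f, y, y₁, y₂, hfc, hfmono, hf0, hfk, hftop, hfbot, hy, hy0, hyf, hy1, hyeq⟩ :=
    hφ.exists_increasing_profile hH hmono
  obtain ⟨r, hr, hchir⟩ : ∃ r, deriv g 0 < r ∧ chi r c h lam = 0 := by
    refine ⟨deriv g 0 - chi (deriv g 0) c h lam * Real.exp (lam * c * h), ?_, ?_⟩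
    · nlinarith [Real.exp_pos (lam * c * h)]
    · have : Real.exp (lam * c * h) * Real.exp (-(lam * c * h)) = 1 := by
        rw [← Real.exp_add]; simp
      unfold chi
      linear_combination
        -(lam ^ 2 - c * lam - 1 + deriv g 0 * Real.exp (-(lam * c * h))) * this
  have hr1 : 1 < r := hH.deriv0_gt.trans hr
  obtain ⟨δ, hδ, hgδ⟩ := hH.exists_lt_mul hr
  obtain ⟨z₀, hz₀⟩ := eventually_atBot.1 (hfbot.eventually_lt_const hδ)
  set A := kap * Real.exp (-(lam * z₀)) with hA
  have hA0 : 0 < A := by positivity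
  have hAz₀ : A * Real.exp (lam * z₀) = kap := by
    rw [hA, mul_assoc, ← Real.exp_add]; simp
  set F₂ : ℝ → ℝ := fun z => g (f (z - c' * h)) with hF₂
  set F : ℝ → ℝ := fun z => min (r * (A * Real.exp (lam * (z - c * h)))) (F₂ z) with hF
  have hF₂c : Continuous F₂ := hH.cont.comp (hfc.comp (by fun_prop))
  have hF₂k : ∀ z, F₂ z ≤ kap := fun z => by
    simpa [hH.map_kap] using hmono.monotone (hfk (z - c' * h))
  have hF0 : ∀ z, 0 ≤ F z := fun z => le_min (by positivity) (hH.nonneg _ (hf0 _))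
  have hFmono : Monotone F := fun u v huv => by
    refine min_le_min ?_ (hmono.monotone (hfmono (by linarith)))
    gcongr
  have hFtop : ∀ m < kap, ∀ᶠ z in atTop, m < F z := by
    intro m hm
    have h1 : Tendsto F₂ atTop (nhds kap) := by
      have := (hH.cont.tendsto kap).comp (hftop.comp
        (tendsto_atTop_add_const_right atTop (-(c' * h)) tendsto_id))
      rwa [hH.map_kap] at this
    have h2 : Tendsto (fun z => r * (A * Real.exp (lam * (z - c * h)))) atTop atTop := by
      refine Tendsto.const_mul_atTop (by linarith) (Tendsto.const_mul_atTop hA0 ?_)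
      exact Real.tendsto_exp_atTop.comp (Tendsto.const_mul_atTop hlam
        (tendsto_atTop_add_const_right atTop (-(c * h)) tendsto_id))
    filter_upwards [h1.eventually_const_lt hm, h2.eventually_gt_atTop m] with z a b
      using lt_min b a
  obtain ⟨b, hb⟩ := (hFtop _ (half_lt_self hk)).exists
  obtain ⟨a, ha⟩ : ∃ a, F a < kap / 2 := by
    have h1 : Tendsto F₂ atBot (nhds 0) := by
      have := (hH.cont.tendsto 0).comp (hfbot.comp
        (tendsto_atBot_add_const_right atBot (-(c' * h)) tendsto_id))
      rwa [hH.map_zero] at this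
    obtain ⟨a, ha⟩ := (h1.eventually_lt_const (half_pos hk)).exists
    exact ⟨a, (min_le_right _ _).trans_lt ha⟩
  obtain ⟨W, W₁, W₂, hW, hW0, hWk, hW1, hWeq⟩ := exists_increasing_solution (c := c) (M := kap)
    (F := F) (by fun_prop) hFmono hF0 (fun z => (min_le_right _ _).trans (hF₂k z)) (ha.trans hb)
  have hWpos : ∀ z, 0 < W z := fun z =>
    (hW0 (z - 1)).trans_lt (hW.strictMono hW1 (by linarith))
  have hWA : ∀ z, W z ≤ A * Real.exp (lam * z) := fun z => by
    have hD := ((IsC2With.exp_mul lam).const_mul A).sub hW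
    have := hD.nonneg_of_linear_ineq (c := c) (M := kap) (fun z => ?_) (fun z => ?_) z
    · linarith
    · have : 0 < A * Real.exp (lam * z) := by positivity
      linarith [hWk z]
    · have h1 : F z ≤ r * (A * Real.exp (lam * (z - c * h))) := min_le_left _ _
      rw [show lam * (z - c * h) = lam * z + -(lam * c * h) by ring, Real.exp_add] at h1
      have h2 : A * Real.exp (lam * z) * chi r c h lam = 0 := by rw [hchir, mul_zero]
      unfold chi at h2
      linarith [hWeq z]
  have hWy : ∀ z, W z ≤ y z := fun z => by
    have := (hy.sub hW).nonneg_of_linear_ineq (c := c) (M := kap) (fun z => ?_) (fun z => ?_) z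
    · linarith
    · linarith [hWk z, hy0 z]
    · have h1 : F z ≤ g (f (z - c' * h)) := min_le_right _ _
      have h2 := mul_pos (sub_pos.2 hc') (hy1 z)
      linarith [hWeq z, hyeq z]
  refine ⟨A, hA0, W, W₁, W₂, hW, hWpos, hWk, hWA, hW1, fun m hm => ?_, fun z => ?_⟩
  · obtain ⟨m', hm', hm'k⟩ := exists_between hm
    obtain ⟨Z, hZ⟩ := eventually_atTop.1 (hFtop m' hm'k)
    exact hW.exists_le_of_source_ge hW0 hF0 hWeq hm' fun z hz => (hZ z hz).le
  · have hlt : g (W (z - c * h)) < F z := by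
      refine lt_min ?_ ?_
      · rcases le_or_gt (z - c * h) z₀ with hz | hz
        · have h1 := hgδ _ (hWpos (z - c * h)) ((hWy _).trans_lt ((hyf _).trans_lt (hz₀ _ hz)))
          exact h1.trans_le (mul_le_mul_of_nonneg_left (hWA _) (by linarith))
        · have h1 : g (W (z - c * h)) ≤ kap := by
            simpa [hH.map_kap] using hmono.monotone (hWk (z - c * h))
          have h2 : kap < A * Real.exp (lam * (z - c * h)) := by
            rw [← hAz₀]
            gcongr
          nlinarith
      · have h1 : z - c * h < z - c' * h := by nlinarith
        exact hmono (((hWy _).trans_lt (hy.strictMono hy1 h1)).trans_le (hyf _))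
    linarith [hWeq z]

theorem hasDerivAt_max_zero_pow (n : ℕ) (x : ℝ) :
    HasDerivAt (fun x : ℝ => max x 0 ^ (n + 2)) ((n + 2) * max x 0 ^ (n + 1)) x := by
  rcases lt_trichotomy x 0 with hx | rfl | hx
  · rw [max_eq_right hx.le]
    refine HasDerivAt.congr_of_eventuallyEq (f := fun _ => 0) ?_ ?_
    · simpa using hasDerivAt_const x (0 : ℝ)
    · filter_upwards [Iio_mem_nhds hx] with y hy
      simp [max_eq_right (mem_Iio.1 hy).le]
  · rw [← hasDerivWithinAt_univ, ← Iic_union_Ici (a := (0 : ℝ))]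
    refine HasDerivWithinAt.union ?_ ?_
    · refine HasDerivWithinAt.congr (f := fun _ => 0) ?_ (fun y hy => ?_) (by simp)
      · simpa using hasDerivWithinAt_const (0 : ℝ) (Iic 0) (0 : ℝ)
      · simp [max_eq_right (mem_Iic.1 hy)]
    · refine HasDerivWithinAt.congr (f := fun y => y ^ (n + 2)) ?_ (fun y hy => ?_) (by simp)
      · simpa using (hasDerivAt_pow (n + 2) (0 : ℝ)).hasDerivWithinAt
      · simp [max_eq_left (mem_Ici.1 hy)]
  · rw [max_eq_left hx.le]
    refine HasDerivAt.congr_of_eventuallyEq (f := fun y => y ^ (n + 2)) ?_ ?_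
    · simpa using hasDerivAt_pow (n + 2) x
    · filter_upwards [Ioi_mem_nhds hx] with y hy
      simp [max_eq_left (mem_Ioi.1 hy).le]

theorem IsC2With.max_zero_cube : IsC2With (fun x => max x 0 ^ 3) (fun x => 3 * max x 0 ^ 2)
    (fun x => 6 * max x 0) := by
  refine ⟨fun z => ?_, fun z => ?_, by fun_prop⟩
  · exact (hasDerivAt_max_zero_pow 1 z).congr_deriv (by norm_num)
  · exact ((hasDerivAt_max_zero_pow 0 z).const_mul 3).congr_deriv (by norm_num; ring)

theorem exists_le_neg_of_continuous_neg {F : ℝ → ℝ} (hF : Continuous F) (hneg : ∀ z, F z < 0)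
    (a b : ℝ) : ∃ τ > 0, ∀ z ∈ Icc a b, F z ≤ -τ := by
  rcases (Icc a b).eq_empty_or_nonempty with h | h
  · exact ⟨1, one_pos, by simp [h]⟩
  · obtain ⟨x, -, hx⟩ := isCompact_Icc.exists_isMaxOn h hF.continuousOn
    exact ⟨-F x, neg_pos.2 (hneg x), fun z hz => by simpa using hx hz⟩

theorem exists_unbounded_supersolution {g : ℝ → ℝ} {kap del0 Lg h c c' lam : ℝ} {φ : ℝ → ℝ}
    (hH : HypH g kap del0 Lg) (hmono : StrictMono g) (hh : 0 < h) (hc : 0 < c) (hc' : c' < c)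
    (hφ : IsWavefront g h c' kap φ) (hlam : 0 < lam) (hchi : chi (deriv g 0) c h lam < 0) :
    ∃ A > 0, ∃ Z, ∃ V V₁ V₂ : ℝ → ℝ, IsC2With V V₁ V₂ ∧ (∀ z, 0 < V z) ∧ (∀ z, 0 < V₁ z) ∧
      (∀ z ≤ Z, V z ≤ A * Real.exp (lam * z)) ∧ Tendsto V atTop atTop ∧
      ∀ z, V₂ z - c * V₁ z - V z + g (V (z - c * h)) < 0 := by
  obtain ⟨A, hA, W, W₁, W₂, hW, hW0, hWk, hWA, hW1, hWtop, hWneg⟩ :=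
    exists_bounded_supersolution hH hmono hh hc' hφ hlam hchi
  obtain ⟨η, hη, hinc⟩ := hH.exists_increment_le
  obtain ⟨Z₁, hZ₁⟩ := hWtop (kap - η) (by linarith)
  have hch : 0 < c * h := mul_pos hc hh
  set Z := Z₁ + c * h with hZ
  have hcont : Continuous fun z => W₂ z - c * W₁ z - W z + g (W (z - c * h)) := by
    have h0 := hW.continuous
    have h1 := hW.continuous₁
    have h2 := hW.2.2
    have h3 := hH.cont
    fun_prop
  obtain ⟨τ, hτ, hτle⟩ := exists_le_neg_of_continuous_neg hcont hWneg Z (Z + 2 / c)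
  set ε := τ * c / 24 with hε
  have hε0 : 0 < ε := by positivity
  have hV := hW.add ((IsC2With.max_zero_cube.comp_add_const (-Z)).const_mul ε)
  refine ⟨A, hA, Z, _, _, _, hV, fun z => ?_, fun z => ?_, fun z hz => ?_, ?_, fun z => ?_⟩
  · have := hW0 z
    positivity
  · have := hW1 z
    positivity
  · rw [max_eq_right (by linarith : z + -Z ≤ 0)]
    simpa using hWA z
  · have h1 : Tendsto (fun z : ℝ => ε * (z + -Z) ^ 3) atTop atTop :=
      ((tendsto_pow_atTop (by norm_num)).comp
        (tendsto_atTop_add_const_right _ _ tendsto_id)).const_mul_atTop hε0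
    refine tendsto_atTop_mono (fun z => ?_) h1
    have h2 : (z + -Z) ^ 3 ≤ max (z + -Z) 0 ^ 3 :=
      (Odd.strictMono_pow (by decide)).monotone (le_max_left _ _)
    have := mul_le_mul_of_nonneg_left h2 hε0.le
    linarith [hW0 z]
  · have hN := hWneg z
    rcases le_or_gt z Z with hz | hz
    · rw [max_eq_right (by linarith : z + -Z ≤ 0), max_eq_right (by linarith : z - c * h + -Z ≤ 0)]
      simpa using hN
    · have hi := hinc (W (z - c * h)) ⟨hZ₁ _ (by linarith), hWk _⟩
        (ε * max (z - c * h + -Z) 0 ^ 3) (by positivity)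
      have hle : max (z - c * h + -Z) 0 ^ 3 ≤ max (z + -Z) 0 ^ 3 := by
        gcongr
        linarith
      have hle' := mul_le_mul_of_nonneg_left hle hε0.le
      rw [max_eq_left (by linarith : 0 ≤ z + -Z)] at hle' ⊢
      have hx : 0 < z + -Z := by linarith
      rcases le_or_gt (z + -Z) (2 / c) with hxc | hxc
      · have h1 := hτle z ⟨hz.le, by linarith⟩
        have h2 : ε * (6 * (z + -Z)) ≤ τ / 2 := by
          calc ε * (6 * (z + -Z)) ≤ ε * (6 * (2 / c)) := by gcongr
            _ = τ / 2 := by rw [hε]; field_simp; norm_num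
        have h3 : 0 ≤ c * (ε * (3 * (z + -Z) ^ 2)) := by positivity
        linarith
      · have h1 : 2 ≤ c * (z + -Z) := by
          rw [div_lt_iff₀ hc] at hxc
          linarith
        have h2 : 0 ≤ 3 * (ε * (z + -Z)) * (c * (z + -Z) - 2) :=
          mul_nonneg (by positivity) (by linarith)
        linarith

theorem chi_neg_of_mem_Ioo {g0 c h lam1 lam2 lam : ℝ} (hg0 : 0 < g0)
    (h1 : chi g0 c h lam1 = 0) (h2 : chi g0 c h lam2 = 0) (hlam : lam ∈ Ioo lam1 lam2) :
    chi g0 c h lam < 0 := by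
  have hd : 0 < lam2 - lam1 := by linarith [hlam.1, hlam.2]
  obtain ⟨a, b, ha, hb, hab, rfl⟩ : ∃ a b : ℝ, 0 < a ∧ 0 < b ∧ a + b = 1 ∧
      a * lam1 + b * lam2 = lam := by
    refine ⟨(lam2 - lam) / (lam2 - lam1), (lam - lam1) / (lam2 - lam1),
      div_pos (by linarith [hlam.2]) hd, div_pos (by linarith [hlam.1]) hd, ?_, ?_⟩
    · field_simp
      ring
    · field_simp
      ring
  have hexp := convexOn_exp.2 (mem_univ (-(lam1 * c * h))) (mem_univ (-(lam2 * c * h)))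
    ha.le hb.le hab
  simp only [smul_eq_mul] at hexp
  rw [show a * -(lam1 * c * h) + b * -(lam2 * c * h) = -((a * lam1 + b * lam2) * c * h) by ring]
    at hexp
  have hexp' := mul_le_mul_of_nonneg_left hexp hg0.le
  have hsq : 0 < a * b * (lam2 - lam1) ^ 2 := by positivity
  obtain rfl : a = 1 - b := by linarith
  unfold chi at h1 h2 ⊢
  linear_combination hexp' + hsq + (1 - b) * h1 + b * h2

theorem tendsto_exp_const_mul_atBot {a : ℝ} (ha : 0 < a) :
    Tendsto (fun z => Real.exp (a * z)) atBot (nhds 0) :=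
  Real.tendsto_exp_atBot.comp (tendsto_id.const_mul_atBot ha)

theorem perturbation_bounds {lam1 lam θ A B E v y : ℝ} (hθ : 0 ≤ θ) (hlam : lam1 ≤ lam)
    (hlamθ : lam - lam1 ≤ lam1 * θ) (hA : 0 ≤ A) (hB : 0 ≤ B) (hE : 0 ≤ E) (hEB : E * (1 + B) ≤ 1)
    (hv : 0 ≤ v) (hvA : v ≤ A * Real.exp (lam * y)) (hy : y ≤ 0) :
    v + E * (Real.exp (lam1 * y) + B * Real.exp (lam * y)) ≤ (A + 1) * Real.exp (lam1 * y) ∧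
    (v + E * (Real.exp (lam1 * y) + B * Real.exp (lam * y))) ^ θ ≤
      (A + 1) ^ θ * Real.exp ((lam - lam1) * y) := by
  have he1 := Real.exp_pos (lam1 * y)
  have hle1 : Real.exp (lam * y) ≤ Real.exp (lam1 * y) :=
    Real.exp_le_exp.2 (mul_le_mul_of_nonpos_right hlam hy)
  have hpE : E * (Real.exp (lam1 * y) + B * Real.exp (lam * y)) ≤ Real.exp (lam1 * y) := by
    calc E * (Real.exp (lam1 * y) + B * Real.exp (lam * y))
        ≤ E * (Real.exp (lam1 * y) + B * Real.exp (lam1 * y)) := by gcongr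
      _ = E * (1 + B) * Real.exp (lam1 * y) := by ring
      _ ≤ Real.exp (lam1 * y) := mul_le_of_le_one_left he1.le hEB
  have hsum : v + E * (Real.exp (lam1 * y) + B * Real.exp (lam * y)) ≤
      (A + 1) * Real.exp (lam1 * y) := by
    have := hvA.trans (mul_le_mul_of_nonneg_left hle1 hA)
    linarith
  refine ⟨hsum, (Real.rpow_le_rpow (by positivity) hsum hθ).trans ?_⟩
  rw [Real.mul_rpow (by positivity) he1.le, ← Real.exp_mul]
  refine mul_le_mul_of_nonneg_left (Real.exp_le_exp.2 ?_) (by positivity)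
  nlinarith

theorem eventually_perturbed_supersolution {g V V₁ V₂ : ℝ → ℝ}
    {kap del0 Lg h c C θ A Z lam1 lam : ℝ}
    (hH : HypH g kap del0 Lg) (hch : 0 < c * h) (hC : 0 < C) (hθ : 0 ≤ θ)
    (hlin : ∀ v x, 0 ≤ v → 0 ≤ x → v + x < del0 →
      g (v + x) - g v - deriv g 0 * x ≤ C * (v + x) ^ θ * x)
    (hlam1 : 0 < lam1) (hlam : lam1 < lam) (hlamθ : lam - lam1 ≤ lam1 * θ)
    (hchi1 : chi (deriv g 0) c h lam1 = 0) (hchi : chi (deriv g 0) c h lam < 0)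
    (hA : 0 < A) (hV : IsC2With V V₁ V₂) (hV0 : ∀ z, 0 < V z)
    (hVA : ∀ z ≤ Z, V z ≤ A * Real.exp (lam * z))
    (hVneg : ∀ z, V₂ z - c * V₁ z - V z + g (V (z - c * h)) < 0) (R : ℝ) :
    ∃ B > 0, ∃ E₀ > 0, ∀ E, 0 < E → E < E₀ → ∀ z ≤ R,
      (V₂ z + E * (lam1 ^ 2 * Real.exp (lam1 * z) + B * (lam ^ 2 * Real.exp (lam * z))))
        - c * (V₁ z + E * (lam1 * Real.exp (lam1 * z) + B * (lam * Real.exp (lam * z))))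
        - (V z + E * (Real.exp (lam1 * z) + B * Real.exp (lam * z)))
        + g (V (z - c * h) + E * (Real.exp (lam1 * (z - c * h))
            + B * Real.exp (lam * (z - c * h)))) < 0 := by
  set m := -chi (deriv g 0) c h lam with hm
  have hm0 : 0 < m := by linarith
  have hlam0 : 0 < lam := hlam1.trans hlam
  set D := C * (A + 1) ^ θ with hD
  have hD0 : 0 < D := by positivity
  set B := 4 * D / m with hB
  have hB0 : 0 < B := by positivity
  have hBm : B * m = 4 * D := div_mul_cancel₀ _ hm0.ne'
  obtain ⟨z₀, hz₀⟩ : ∃ z₀, ∀ y ≤ z₀, y ≤ Z ∧ y ≤ 0 ∧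
      D * Real.exp ((lam - lam1) * y) < m / 2 ∧ (A + 1) * Real.exp (lam1 * y) < del0 := by
    refine eventually_atBot.1 ((eventually_le_atBot Z).and ((eventually_le_atBot 0).and
      (Eventually.and ?_ ?_)))
    · have := (tendsto_exp_const_mul_atBot (sub_pos.2 hlam)).const_mul D
      rw [mul_zero] at this
      exact this.eventually_lt_const (half_pos hm0)
    · have := (tendsto_exp_const_mul_atBot hlam1).const_mul (A + 1)
      rw [mul_zero] at this
      exact this.eventually_lt_const hH.del0_pos
  have hcont : Continuous fun z => V₂ z - c * V₁ z - V z + g (V (z - c * h)) := by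
    have h0 := hV.continuous
    have h1 := hV.continuous₁
    have h2 := hV.2.2
    have h3 := hH.cont
    fun_prop
  obtain ⟨τ, hτ, hτle⟩ := exists_le_neg_of_continuous_neg hcont hVneg z₀ R
  obtain ⟨M, hM⟩ := (isCompact_Icc (a := z₀) (b := R)).exists_bound_of_continuousOn
    (f := fun z => (lam1 ^ 2 * Real.exp (lam1 * z) + B * (lam ^ 2 * Real.exp (lam * z)))
      - c * (lam1 * Real.exp (lam1 * z) + B * (lam * Real.exp (lam * z)))
      - (Real.exp (lam1 * z) + B * Real.exp (lam * z))
      + Lg * (Real.exp (lam1 * (z - c * h)) + B * Real.exp (lam * (z - c * h))))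
    (by fun_prop)
  refine ⟨B, hB0, min (1 / (1 + B)) (τ / (|M| + 1)), by positivity, fun E hE hEE z hzR => ?_⟩
  obtain ⟨hE1, hE2⟩ := lt_min_iff.1 hEE
  rw [lt_div_iff₀ (by positivity)] at hE1 hE2
  have hVz := hVneg z
  rcases le_or_gt z z₀ with hz | hz
  · obtain ⟨hyZ, hy0, hyD, hydel⟩ := hz₀ (z - c * h) (by linarith)
    have hez : Real.exp (lam * (z - c * h)) ≤ Real.exp (lam * z) := by
      gcongr
      linarith
    have hid1 : Real.exp (lam1 * (z - c * h)) =
        Real.exp (-(lam1 * c * h)) * Real.exp (lam1 * z) := by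
      rw [← Real.exp_add]; ring_nf
    have hid2 : Real.exp (lam * (z - c * h)) =
        Real.exp (-(lam * c * h)) * Real.exp (lam * z) := by
      rw [← Real.exp_add]; ring_nf
    have hop : lam1 ^ 2 * Real.exp (lam1 * z) + B * (lam ^ 2 * Real.exp (lam * z))
        - c * (lam1 * Real.exp (lam1 * z) + B * (lam * Real.exp (lam * z)))
        - (Real.exp (lam1 * z) + B * Real.exp (lam * z))
        + deriv g 0 * (Real.exp (lam1 * (z - c * h)) + B * Real.exp (lam * (z - c * h)))
        = -(B * m * Real.exp (lam * z)) := by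
      rw [hid1, hid2, hm]
      unfold chi at hchi1 ⊢
      linear_combination Real.exp (lam1 * z) * hchi1
    set y := z - c * h with hy
    set p := Real.exp (lam1 * y) + B * Real.exp (lam * y) with hp
    set d := Real.exp ((lam - lam1) * y) with hd
    have hsplit : Real.exp (lam * y) = Real.exp (lam1 * y) * d := by
      rw [hd, ← Real.exp_add]; ring_nf
    have he := Real.exp_pos (lam * y)
    have hd0 : 0 < d := Real.exp_pos _
    have hp0 : 0 < p := by positivity
    obtain ⟨hsum, hpow⟩ := perturbation_bounds hθ hlam.le hlamθ hA.le hB0.le hE.le hE1.le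
      (hV0 y).le (hVA y hyZ) hy0
    rw [← hp] at hsum hpow
    have hl := hlin (V y) (E * p) (hV0 y).le (by positivity) (hsum.trans_lt hydel)
    have hl2 := mul_le_mul_of_nonneg_right (mul_le_mul_of_nonneg_left hpow hC.le)
      (mul_pos hE hp0).le
    rw [← mul_assoc C, ← hD, ← hd] at hl2
    have hDdp : D * d * p ≤ 3 * D * Real.exp (lam * y) := by
      have h1 : D * d * p = Real.exp (lam * y) * D + B * (D * d) * Real.exp (lam * y) := by
        rw [hp]
        linear_combination (-D) * hsplit
      have h2 : B * (D * d) ≤ 2 * D := by nlinarith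
      have h3 := mul_le_mul_of_nonneg_right h2 he.le
      linarith
    have hDdp' := mul_le_mul_of_nonneg_left hDdp hE.le
    have hop' := congrArg (E * ·) hop
    rw [hBm] at hop'
    have h4 : E * (4 * D * Real.exp (lam * y)) ≤ E * (4 * D * Real.exp (lam * z)) := by gcongr
    have h5 : 0 < E * (D * Real.exp (lam * y)) := by positivity
    linarith
  · have h1 := hτle z ⟨hz.le, hzR⟩
    have h2 := (le_abs_self _).trans (hM z ⟨hz.le, hzR⟩)
    set y := z - c * h with hy
    set p := Real.exp (lam1 * y) + B * Real.exp (lam * y) with hp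
    have hp0 : 0 < p := by positivity
    have hl := (le_abs_self _).trans (hH.lipschitz (V y + E * p) (V y)
      (by have := hV0 y; positivity) (hV0 y).le)
    rw [add_sub_cancel_left, abs_of_pos (by positivity)] at hl
    have h3 := mul_le_mul_of_nonneg_left (h2.trans (le_abs_self M)) hE.le
    linarith

/-- **Lemma `Lem2` (construction of an unbounded super-solution dominating `w₀`).**
For `c > c_*` and an initial datum `w₀ ≤ K` with leading term `e^{λ₁z}` at `−∞`,
for each `ς > 0` there are `L` and a `C²` increasing function `ψ` with
`ψ(z)e^{−λ₁z} → 1+ς` at `−∞`, `ψ(L) = K`, `ψ(+∞) = +∞`, dominating `w₀` on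
`(−∞,L]` and satisfying the strict differential inequality there. -/
theorem unbounded_supersolution_construction
    (g : ℝ → ℝ) (kap del0 Lg h c : ℝ)
    (hH : HypH g kap del0 Lg) (hmono : StrictMono g)
    (hh : 0 < h) (hc : 0 < c)
    -- c > c_* : χ₀(·;c) has two distinct positive real zeros λ₁ < λ₂ …
    (lam1 lam2 : ℝ) (hlam1_pos : 0 < lam1) (hlam_lt : lam1 < lam2)
    (hchi1 : chi (deriv g 0) c h lam1 = 0) (hchi2 : chi (deriv g 0) c h lam2 = 0)
    -- … a monotone wavefront with speed c exists and is unique up to translation …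
    (hfront : ∃ φ : ℝ → ℝ, IsWavefront g h c kap φ ∧ Monotone φ ∧
        ∀ ψ : ℝ → ℝ, IsWavefront g h c kap ψ → Monotone ψ →
          ∃ σ : ℝ, ∀ z : ℝ, ψ z = φ (z + σ))
    -- … and a wavefront with some smaller speed exists
    (hlower : ∃ c' < c, ∃ φ' : ℝ → ℝ, IsWavefront g h c' kap φ')
    -- the initial datum: 0 ≤ w₀ ≤ K, (IC2), and leading term e^{λ₁z} at −∞
    (w0 : ℝ → ℝ → ℝ) (K : ℝ) (hK : 0 < K)
    (hw0 : ∀ s ∈ Set.Icc (-h) 0, ∀ z : ℝ, 0 ≤ w0 s z ∧ w0 s z ≤ K)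
    (hIC2 : IC2 h w0)
    (hlim : ∀ ε > (0:ℝ), ∃ Z : ℝ, ∀ z ≤ Z, ∀ s ∈ Set.Icc (-h) 0,
        |w0 s z * Real.exp (-(lam1 * z)) - 1| ≤ ε) :
    ∀ ς > (0:ℝ), ∃ L : ℝ, ∃ ψ : ℝ → ℝ,
      ContDiff ℝ 2 ψ ∧
      Filter.Tendsto (fun z => ψ z * Real.exp (-(lam1 * z)))
        Filter.atBot (nhds (1 + ς)) ∧
      (∀ z : ℝ, 0 < deriv ψ z) ∧
      ψ L = K ∧
      Filter.Tendsto ψ Filter.atTop Filter.atTop ∧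
      (∀ z ≤ L, ∀ s ∈ Set.Icc (-h) 0, w0 s z < ψ z) ∧
      (∀ z ≤ L,
        deriv (deriv ψ) z - c * deriv ψ z - ψ z + g (ψ (z - c * h)) < 0) := by
  intro ς hς
  obtain ⟨c', hc', φ, hφ⟩ := hlower
  obtain ⟨C, hC, θ, hθ, hlin⟩ := hH.exists_linearization_bound
  obtain ⟨lam, hlam1, hlam⟩ : ∃ lam, lam1 < lam ∧ lam < min lam2 (lam1 + lam1 * θ) :=
    exists_between (lt_min hlam_lt (by have := mul_pos hlam1_pos hθ.1; linarith))
  obtain ⟨hlam2, hlamθ⟩ := lt_min_iff.1 hlam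
  have hchi : chi (deriv g 0) c h lam < 0 :=
    chi_neg_of_mem_Ioo (one_pos.trans hH.deriv0_gt) hchi1 hchi2 ⟨hlam1, hlam2⟩
  have hlam0 : 0 < lam := hlam1_pos.trans hlam1
  obtain ⟨A, hA, Zv, V, V₁, V₂, hV, hV0, hV1, hVA, hVtop, hVneg⟩ :=
    exists_unbounded_supersolution hH hmono hh hc hc' hφ hlam0 hchi
  obtain ⟨R, hR⟩ := (hVtop.eventually_ge_atTop K).exists
  obtain ⟨B, hB, E₀, hE₀, hsuper⟩ := eventually_perturbed_supersolution hH (mul_pos hc hh) hC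
    hθ.1.le hlin hlam1_pos hlam1 (by linarith) hchi1 hchi hA hV hV0 hVA hVneg R
  obtain ⟨Z, hZ⟩ := hlim (ς / 2) (half_pos hς)
  obtain ⟨τ, hτE, hτR⟩ : ∃ τ, (1 + ς) * Real.exp (-lam1 * τ) < E₀ ∧ R - Z ≤ τ := by
    have h1 : Tendsto (fun τ => (1 + ς) * Real.exp (-lam1 * τ)) atTop (nhds 0) := by
      have := (Real.tendsto_exp_atBot.comp
        (tendsto_id.const_mul_atTop_of_neg (neg_lt_zero.2 hlam1_pos))).const_mul (1 + ς)
      rwa [mul_zero] at this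
    exact ((h1.eventually_lt_const hE₀).and (eventually_ge_atTop _)).exists
  set E := (1 + ς) * Real.exp (-lam1 * τ) with hE
  have hE0 : 0 < E := by positivity
  have hP := hV.add (((IsC2With.exp_mul lam1).add ((IsC2With.exp_mul lam).const_mul B)).const_mul E)
  have hP1 : ∀ z, 0 < V₁ z + E * (lam1 * Real.exp (lam1 * z) + B * (lam * Real.exp (lam * z))) :=
    fun z => by have := hV1 z; positivity
  have hPmono := hP.strictMono hP1
  have hψ := hP.comp_add_const τ
  set P : ℝ → ℝ := fun z => V z + E * (Real.exp (lam1 * z) + B * Real.exp (lam * z)) with hPdef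
  have hPV : ∀ z, V z < P z := fun z => lt_add_of_pos_right _ (by positivity)
  have hshift : ∀ z, E * Real.exp (lam1 * (z + τ)) = (1 + ς) * Real.exp (lam1 * z) := fun z => by
    rw [hE, mul_assoc, ← Real.exp_add]
    ring_nf
  have hPtop : Tendsto P atTop atTop := tendsto_atTop_mono (fun z => (hPV z).le) hVtop
  have hPbot : Tendsto (fun z => P (z + τ) * Real.exp (-(lam1 * z))) atBot (nhds (1 + ς)) := by
    have hinv : ∀ z, Real.exp (lam1 * z) * Real.exp (-(lam1 * z)) = 1 := fun z => by
      rw [← Real.exp_add, add_neg_cancel, Real.exp_zero]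
    have heq : ∀ z, P (z + τ) * Real.exp (-(lam1 * z)) = 1 + ς
        + (V (z + τ) + E * B * Real.exp (lam * (z + τ))) * Real.exp (-(lam1 * z)) := fun z => by
      rw [hPdef]
      linear_combination Real.exp (-(lam1 * z)) * hshift z + (1 + ς) * hinv z
    have hup := ((tendsto_exp_const_mul_atBot (sub_pos.2 hlam1)).const_mul
      ((A + E * B) * Real.exp (lam * τ))).const_add (1 + ς)
    rw [mul_zero, add_zero] at hup
    refine tendsto_of_tendsto_of_tendsto_of_le_of_le' tendsto_const_nhds hup
      (Eventually.of_forall fun z => ?_) ?_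
    · rw [heq]
      have := hV0 (z + τ)
      exact le_add_of_nonneg_right (by positivity)
    · filter_upwards [eventually_le_atBot (Zv - τ)] with z hz
      rw [heq]
      have h1 := hVA (z + τ) (by linarith)
      have h2 : Real.exp (lam * τ) * Real.exp ((lam - lam1) * z) =
          Real.exp (lam * (z + τ)) * Real.exp (-(lam1 * z)) := by
        rw [← Real.exp_add, ← Real.exp_add]
        ring_nf
      have h3 := mul_le_mul_of_nonneg_right h1 (Real.exp_pos (-(lam1 * z))).le
      linear_combination h3 - (A + E * B) * h2
  obtain ⟨L, hL⟩ : ∃ L, P L = K := by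
    have hbot : ∃ z, P z < K := by
      have h1 : Tendsto (fun z => A * Real.exp (lam * z)
          + E * (Real.exp (lam1 * z) + B * Real.exp (lam * z))) atBot (nhds 0) := by
        have e1 := tendsto_exp_const_mul_atBot hlam1_pos
        have e2 := tendsto_exp_const_mul_atBot hlam0
        simpa using (e2.const_mul A).add ((e1.add (e2.const_mul B)).const_mul E)
      obtain ⟨z, hz, hzZ⟩ := ((h1.eventually_lt_const hK).and (eventually_le_atBot Zv)).exists
      exact ⟨z, (add_le_add_left (hVA z hzZ) _).trans_lt hz⟩
    obtain ⟨z, hz⟩ := hbot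
    exact mem_range_of_exists_le_of_exists_ge hP.continuous ⟨z, hz.le⟩
      ⟨R, hR.trans (hPV R).le⟩
  have hLR : L ≤ R := hPmono.le_iff_le.1 (by linarith [hPV R])
  refine ⟨L - τ, fun z => P (z + τ), hψ.contDiff, hPbot, fun z => ?_, ?_, ?_, fun z hz s hs => ?_,
    fun z hz => ?_⟩
  · rw [hψ.deriv_eq]
    exact hP1 _
  · simpa using hL
  · exact hPtop.comp (tendsto_atTop_add_const_right _ _ tendsto_id)
  · have h1 := (le_abs_self _).trans (hZ z (by linarith) s hs)
    rw [Real.exp_neg, ← div_eq_mul_inv, sub_le_iff_le_add, div_le_iff₀ (Real.exp_pos _)] at h1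
    have h2 : (1 + ς) * Real.exp (lam1 * z) < P (z + τ) := by
      rw [← hshift]
      have h3 : 0 < E * (B * Real.exp (lam * (z + τ))) := by positivity
      have h4 : P (z + τ) = V (z + τ) + E * (Real.exp (lam1 * (z + τ))
        + B * Real.exp (lam * (z + τ))) := rfl
      linarith [hV0 (z + τ)]
    have h3 : 0 < ς / 2 * Real.exp (lam1 * z) := by positivity
    linarith
  · have hneg := hsuper E hE0 hτE (z + τ) (by linarith)
    rw [show z + τ - c * h = z - c * h + τ by ring] at hneg
    rw [hψ.deriv_deriv_eq, hψ.deriv_eq]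
    exact hneg
end
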